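/- Notation. Let $\gamma_1$ be the standard Gaussian probability measure on $\mathbb{R}$, with density $\rho(y)=(2\pi)^{-1/2}e^{-y^2/2}$, and let $\gamma=\bigotimes_{j\ge 1}\gamma_1$ be the countable product measure on $\mathbb{R}^{\mathbb{N}}$. Let $H_n(y)=\frac{(-1)^n}{\sqrt{n!}}\,\frac{\rho^{(n)}(y)}{\rho(y)}$, $n\ge 0$, be the orthonormal Hermite polynomials. Let $\mathcal F$ be the set of finitely supported multi-indices $\nu=(\nu_j)_{j\ge1}$ with $\nu_j\in\mathbb{N}=\{0,1,2,\dots\}$; put $\operatorname{supp}\nu=\{j:\nu_j\neq 0\}$ and $H_\nu(y)=\prod_{j\in\operatorname{supp}\nu}H_{\nu_j}(y_j)$. A set $\Lambda\subseteq\mathcal F$ is downward closed if $\nu\in\Lambda$, $\mu\in\mathcal F$ and $\mu_j\le\nu_j$ for all $j$ imply $\mu\in\Lambda$. Quadrature. For every level $l\in\mathbb{N}$ let $Q_l(g)=\sum_{k=0}^{m_l-1}w_k^l\,g(y_k^l)$ be a univariate quadrature with finitely many nodes $y_k^l\in\mathbb{R}$ and weights $w_k^l\in\mathbb{R}$, where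 the level-zero rule is evaluation at the origin, $Q_0(g)=g(0)$. For $\nu\in\mathcal F$ let $\Delta_\nu=\bigotimes_{j\in\operatorname{supp}\nu}(Q_{\nu_j}-Q_{\nu_j-1})$, i.e. $\Delta_\nu(f)$ is the sum over $T\subseteq\operatorname{supp}\nu$ of $(-1)^{|T|}$ times the tensor-product quadrature of $f$ in the coordinates $j\in\operatorname{supp}\nu$ with level $\nu_j-1$ for $j\in T$ and level $\nu_j$ for $j\notin T$, all coordinates outside $\operatorname{supp}\nu$ being set to $0$. For finite $\Lambda\subseteq\mathcal F$ put $Q_\Lambda(f)=\sum_{\nu\in\Lambda}\Delta_\nu(f)$. Assumptions on the quadrature. (A.1) For every $l$, $Q_l(p)=\int_{\mathbb{R}}p\,d\gamma_1$ for every polynomial $p$ of degree at most $l$. (A.2) $|Q_l(H_n)|<2$ for all $l,n\in\mathbb{N}$. Statement. Let $S$ be a real Banach space and assume A.1 and A.2. Let $f:\mathbb{R}^{\mathbb{N}}\to S$ be Bochner integrable with respect to $\gamma$, with Hermite coefficients $f_\nu=\int_{\mathbb{R}^{\mathbb{N}}}f(y)H_\nu(y)\,d\gamma(y)\in S$ for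 each $\nu\in\mathcal F$. Assume that at every point $y\in\mathbb{R}^{\mathbb{N}}$ having finitely many nonzero coordinates the series $\sum_{\nu\in\mathcal F}f_\nu H_\nu(y)$ converges absolutely to $f(y)$, and that $\sum_{\nu\in\mathcal F}c_\nu\|f_\nu\|_S<\infty$, where $c_\nu=\prod_{j\in\operatorname{supp}\nu}(1+\nu_j)^3$. Then for every finite downward closed set $\Lambda\subseteq\mathcal F$, $$\Big\|\int_{\mathbb{R}^{\mathbb{N}}}f\,d\gamma-Q_\Lambda(f)\Big\|_S\le\sum_{\nu\in\mathcal F\setminus\Lambda}c_\nu\|f_\nu\|_S .$$ -/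

import Mathlib

open MeasureTheory ProbabilityTheory

/-- The orthonormal (probabilists') Hermite polynomial `H_n(x) = He_n(x) / √(n!)`. -/
noncomputable def Hnorm (n : ℕ) (x : ℝ) : ℝ :=
  Polynomial.aeval x (Polynomial.hermite n) / Real.sqrt (Nat.factorial n)

/-- Rodrigues formula: `H_n = ((-1)^n / √(n!)) ρ^{(n)} / ρ`, with `ρ` the standard Gaussian
density. -/
theorem Hnorm_eq_iteratedDeriv (n : ℕ) (x : ℝ) :
    Hnorm n x = (-1) ^ n / Real.sqrt (Nat.factorial n) *
      (iteratedDeriv n (gaussianPDFReal 0 1) x / gaussianPDFReal 0 1 x) := by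
  have hρ : gaussianPDFReal 0 1 =
      fun y => (Real.sqrt (2 * Real.pi))⁻¹ * Real.exp (-(y ^ 2 / 2)) := by
    funext y
    simp [gaussianPDFReal, neg_div]
  have hc : (Real.sqrt (2 * Real.pi))⁻¹ ≠ 0 := by positivity
  rw [hρ, iteratedDeriv_const_mul_field, mul_div_mul_left _ _ hc, iteratedDeriv_eq_iterate,
    Hnorm, Polynomial.hermite_eq_deriv_gaussian]
  ring

/-- A family of univariate quadrature rules: level `l` has the nodes `node l k` and the weights
`weight l k` for `k < m l`. -/
structure QuadFamily where
  m : ℕ → ℕ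
  node : ℕ → ℕ → ℝ
  weight : ℕ → ℕ → ℝ

/-- The univariate quadrature `Q_l(g) = Σ_{k < m_l} w_k^l g(y_k^l)`. -/
noncomputable def QuadFamily.quad {E : Type*} [NormedAddCommGroup E] [NormedSpace ℝ E]
    (Q : QuadFamily) (l : ℕ) (g : ℝ → E) : E :=
  ∑ k ∈ Finset.range (Q.m l), Q.weight l k • g (Q.node l k)

/-- The level-zero quadrature is the one-point rule `Q_0(g) = g(0)`. -/
def QuadFamily.ZeroRule (Q : QuadFamily) : Prop :=
  ∀ g : ℝ → ℝ, Q.quad 0 g = g 0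

/-- Assumption A.1: `Q_l` integrates exactly every polynomial of degree `≤ l`
against the standard Gaussian measure. -/
def QuadFamily.ExactA1 (Q : QuadFamily) : Prop :=
  ∀ l : ℕ, ∀ p : Polynomial ℝ, p.natDegree ≤ l →
    Q.quad l (fun x => p.eval x) = ∫ x, p.eval x ∂(gaussianReal 0 1)

/-- Assumption A.2: `|Q_l(H_n)| < 2` for all levels `l` and degrees `n`. -/
def QuadFamily.BoundedA2 (Q : QuadFamily) : Prop :=
  ∀ l n : ℕ, |Q.quad l (Hnorm n)| < 2

/-- Tensor-product quadrature over the finite set `s` of dimensions, at levels `lev j`,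
applied to `f : ℝ^ℕ → E`, coordinates outside `s` being evaluated at `0`. -/
noncomputable def QuadFamily.tensor {E : Type*} [NormedAddCommGroup E] [NormedSpace ℝ E]
    (Q : QuadFamily) (s : Finset ℕ) (lev : ℕ → ℕ) (f : (ℕ → ℝ) → E) : E :=
  ∑ k ∈ s.pi (fun j => Finset.range (Q.m (lev j))),
    (∏ j ∈ s.attach, Q.weight (lev j.1) (k j.1 j.2)) •
      f (fun j => if h : j ∈ s then Q.node (lev j) (k j h) else 0)

/-- The tensorized difference operator `Δ_ν = ⊗_{j ∈ supp ν} (Q_{ν_j} - Q_{ν_j - 1})`, expanded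
as the alternating-sign sum over subsets `T ⊆ supp ν` of the tensor quadrature at levels
`ν - 1_T`. Since `ν_j ≥ 1` on `supp ν`, the subtraction never truncates there. -/
noncomputable def QuadFamily.delta {E : Type*} [NormedAddCommGroup E] [NormedSpace ℝ E]
    (Q : QuadFamily) (ν : ℕ →₀ ℕ) (f : (ℕ → ℝ) → E) : E :=
  ∑ T ∈ ν.support.powerset, (-1 : ℝ) ^ T.card •
    Q.tensor ν.support (fun j => ν j - (if j ∈ T then 1 else 0)) f

/-- The sparse quadrature `Q_Λ(f) = Σ_{ν ∈ Λ} Δ_ν(f)`. -/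
noncomputable def QuadFamily.sparse {E : Type*} [NormedAddCommGroup E] [NormedSpace ℝ E]
    (Q : QuadFamily) (Λ : Finset (ℕ →₀ ℕ)) (f : (ℕ → ℝ) → E) : E :=
  ∑ ν ∈ Λ, Q.delta ν f

/-- The countable product of standard Gaussian measures on `ℝ^ℕ`. -/
noncomputable def gaussianProd : Measure (ℕ → ℝ) :=
  Measure.infinitePi (fun _ : ℕ => gaussianReal 0 1)

/-- The multivariate Hermite polynomial `H_ν(y) = ∏_{j ∈ supp ν} H_{ν_j}(y_j)`. -/
noncomputable def Hmulti (ν : ℕ →₀ ℕ) (y : ℕ → ℝ) : ℝ :=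
  ∏ j ∈ ν.support, Hnorm (ν j) (y j)

/-- The Hermite coefficient `f_ν = ∫ f H_ν dγ`. -/
noncomputable def hermiteCoeff {E : Type*} [NormedAddCommGroup E] [NormedSpace ℝ E]
    (f : (ℕ → ℝ) → E) (ν : ℕ →₀ ℕ) : E :=
  ∫ y, Hmulti ν y • f y ∂gaussianProd

/-- The weight `c_ν = ∏_{j ∈ supp ν} (1 + ν_j)³`. -/
noncomputable def cwt (ν : ℕ →₀ ℕ) : ℝ :=
  ∏ j ∈ ν.support, ((1 : ℝ) + ν j) ^ 3

/-- Polynomials are integrable against a Gaussian measure. -/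
theorem integrable_eval_gaussianReal (p : Polynomial ℝ) (μ : ℝ) (v : NNReal) :
    Integrable (fun x => p.eval x) (gaussianReal μ v) := by
  have hpow (n : ℕ) : Integrable (fun x : ℝ => x ^ n) (gaussianReal μ v) := by
    have h := (memLp_id_gaussianReal (μ := μ) (v := v) n).integrable_norm_pow'
    refine h.mono' (by fun_prop) (Filter.Eventually.of_forall fun x => ?_)
    simp
  simp only [Polynomial.eval_eq_sum_range]
  exact integrable_finsetSum _ fun i _ => (hpow i).const_mul _

theorem integrable_eval_mul_gaussianPDFReal (p : Polynomial ℝ) :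
    Integrable (fun x => p.eval x * gaussianPDFReal 0 1 x) := by
  have h := integrable_eval_gaussianReal p 0 1
  rw [gaussianReal_of_var_ne_zero 0 one_ne_zero,
    integrable_withDensity_iff_integrable_smul' (measurable_gaussianPDF 0 1)
      (Filter.Eventually.of_forall fun x => gaussianPDF_lt_top)] at h
  simpa [toReal_gaussianPDF, mul_comm] using h

theorem hasDerivAt_gaussianPDFReal (x : ℝ) :
    HasDerivAt (gaussianPDFReal 0 1) (-x * gaussianPDFReal 0 1 x) x := by
  have hρ : gaussianPDFReal 0 1 =
      fun y => (Real.sqrt (2 * Real.pi))⁻¹ * Real.exp (-y ^ 2 / 2) := by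
    funext y
    simp [gaussianPDFReal]
  rw [hρ]
  have h1 : HasDerivAt (fun y : ℝ => -y ^ 2 / 2) (-x) x := by
    have := ((hasDerivAt_pow 2 x).neg).div_const 2
    convert! this using 1
    simp
    ring
  convert! (h1.exp).const_mul (Real.sqrt (2 * Real.pi))⁻¹ using 1
  ring

/-- The orthonormal Hermite polynomial as an element of `ℝ[X]`. -/
noncomputable def hermitePoly (n : ℕ) : Polynomial ℝ :=
  Polynomial.C (Real.sqrt (Nat.factorial n))⁻¹ *
    (Polynomial.hermite n).map (Int.castRingHom ℝ)

theorem Hnorm_eq_eval (n : ℕ) : Hnorm n = fun x => (hermitePoly n).eval x := by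
  funext x
  simp [Hnorm, hermitePoly, Polynomial.aeval_def, Polynomial.eval_map, div_eq_inv_mul]

theorem natDegree_hermitePoly_le (n : ℕ) : (hermitePoly n).natDegree ≤ n := by
  refine (Polynomial.natDegree_C_mul_le _ _).trans (Polynomial.natDegree_map_le.trans ?_)
  rw [Polynomial.natDegree_hermite]

theorem Hnorm_zero (x : ℝ) : Hnorm 0 x = 1 := by
  simp [Hnorm]

/-- The Hermite polynomials of positive degree have zero Gaussian mean. -/
theorem integral_Hnorm_succ (n : ℕ) : ∫ x, Hnorm (n + 1) x ∂(gaussianReal 0 1) = 0 := by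
  set p : Polynomial ℝ := (Polynomial.hermite n).map (Int.castRingHom ℝ) with hp
  have key : ∫ x, (Polynomial.derivative p - Polynomial.X * p).eval x
      * gaussianPDFReal 0 1 x = 0 := by
    refine integral_eq_zero_of_hasDerivAt_of_integrable
      (f := fun x => p.eval x * gaussianPDFReal 0 1 x) (fun x => ?_)
      (integrable_eval_mul_gaussianPDFReal _) (integrable_eval_mul_gaussianPDFReal _)
    convert! (p.hasDerivAt x).mul (hasDerivAt_gaussianPDFReal x) using 1
    simp
    ring
  have hH (x : ℝ) : Hnorm (n + 1) x = -(Real.sqrt (Nat.factorial (n + 1)))⁻¹ *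
      (Polynomial.derivative p - Polynomial.X * p).eval x := by
    rw [Hnorm_eq_eval, hermitePoly, Polynomial.hermite_succ]
    simp only [Polynomial.eval_mul, Polynomial.eval_C, Polynomial.map_sub, Polynomial.map_mul,
      Polynomial.map_X, ← Polynomial.derivative_map, ← hp, Polynomial.eval_sub]
    ring
  rw [integral_gaussianReal_eq_integral_smul one_ne_zero]
  simp only [hH, smul_eq_mul]
  simp only [mul_left_comm (gaussianPDFReal 0 1 _)]
  rw [integral_const_mul]
  simp only [mul_comm (gaussianPDFReal 0 1 _), key, mul_zero]

theorem Hmulti_eq_prod {ν : ℕ →₀ ℕ} {U : Finset ℕ} (hU : ν.support ⊆ U) (y : ℕ → ℝ) :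
    Hmulti ν y = ∏ j ∈ U, Hnorm (ν j) (y j) := by
  refine Finset.prod_subset hU fun j _ hj => ?_
  rw [Finsupp.notMem_support_iff.1 hj, Hnorm_zero]

theorem Hmulti_zero (y : ℕ → ℝ) : Hmulti 0 y = 1 := by
  simp [Hmulti]

theorem hermiteCoeff_zero {E : Type*} [NormedAddCommGroup E] [NormedSpace ℝ E]
    (f : (ℕ → ℝ) → E) : hermiteCoeff f 0 = ∫ y, f y ∂gaussianProd := by
  simp [hermiteCoeff, Hmulti_zero]

/-- A sum over the order ideal of `ν` of products over `supp ν` factorizes. -/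
theorem Finsupp.sum_Iic_prod {ι R : Type*} [DecidableEq ι] [CommSemiring R] (ν : ι →₀ ℕ)
    (g : ι → ℕ → R) :
    ∑ μ ∈ Finset.Iic ν, ∏ j ∈ ν.support, g j (μ j) =
      ∏ j ∈ ν.support, ∑ m ∈ Finset.range (ν j + 1), g j m := by
  have hI : Finset.Iic ν = ν.support.finsupp (fun j => Finset.range (ν j + 1)) := by
    ext μ
    rw [Finset.mem_Iic, Finset.mem_finsupp_iff]
    constructor
    · intro h
      exact ⟨Finsupp.support_mono h, fun i _ => Finset.mem_range.2 (Nat.lt_succ_of_le (h i))⟩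
    · rintro ⟨h1, h2⟩ i
      by_cases hi : i ∈ ν.support
      · exact Nat.le_of_lt_succ (Finset.mem_range.1 (h2 i hi))
      · rw [Finsupp.notMem_support_iff.1 fun h => hi (h1 h)]
        exact Nat.zero_le _
  rw [hI, Finset.finsupp, Finset.sum_map, Finset.prod_sum]
  refine Finset.sum_congr (by congr!) fun p _ => ?_
  rw [← Finset.prod_attach]
  refine Finset.prod_congr rfl fun j _ => ?_
  congr 1
  exact Finsupp.indicator_of_mem j.2 p

namespace QuadFamily

variable (Q : QuadFamily)

/-- Tensor quadrature of a product function is the product of the univariate quadratures. -/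
theorem tensor_prod {s U : Finset ℕ} (hs : s ⊆ U) (lev : ℕ → ℕ) (g : ℕ → ℝ → ℝ) :
    Q.tensor s lev (fun y => ∏ j ∈ U, g j (y j)) =
      (∏ j ∈ s, Q.quad (lev j) (g j)) * ∏ j ∈ U \ s, g j 0 := by
  simp only [tensor, quad, smul_eq_mul]
  rw [Finset.prod_sum, Finset.sum_mul]
  refine Finset.sum_congr rfl fun k _ => ?_
  rw [Finset.prod_mul_distrib, mul_assoc, ← Finset.prod_sdiff hs]
  congr 1
  rw [mul_comm]
  congr 1
  · rw [← Finset.prod_attach]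
    refine Finset.prod_congr rfl fun j _ => ?_
    simp
  · refine Finset.prod_congr rfl fun j hj => ?_
    simp [(Finset.mem_sdiff.1 hj).2]

/-- The univariate difference `(Q_m - Q_{m-1})(H_n)`, with `Q_{-1} = 0`. -/
noncomputable def hermiteDiff : ℕ → ℕ → ℝ
  | 0, n => Q.quad 0 (Hnorm n)
  | m + 1, n => Q.quad (m + 1) (Hnorm n) - Q.quad m (Hnorm n)

variable {Q}

theorem delta_Hmulti (hQ0 : Q.ZeroRule) (μ ν : ℕ →₀ ℕ) {U : Finset ℕ}
    (hμ : μ.support ⊆ U) (hν : ν.support ⊆ U) :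
    Q.delta μ (Hmulti ν) = ∏ j ∈ U, Q.hermiteDiff (μ j) (ν j) := by
  have hH : Hmulti ν = fun y => ∏ j ∈ U, Hnorm (ν j) (y j) :=
    funext fun y => Hmulti_eq_prod hν y
  have hin : ∏ j ∈ μ.support, Q.hermiteDiff (μ j) (ν j) =
      ∏ j ∈ μ.support, (Q.quad (μ j) (Hnorm (ν j)) - Q.quad (μ j - 1) (Hnorm (ν j))) := by
    refine Finset.prod_congr rfl fun j hj => ?_
    obtain ⟨m, hm⟩ := Nat.exists_eq_succ_of_ne_zero (Finsupp.mem_support_iff.1 hj)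
    simp [hm, hermiteDiff]
  have hout : ∏ j ∈ U \ μ.support, Q.hermiteDiff (μ j) (ν j) =
      ∏ j ∈ U \ μ.support, Hnorm (ν j) 0 := by
    refine Finset.prod_congr rfl fun j hj => ?_
    rw [Finsupp.notMem_support_iff.1 (Finset.mem_sdiff.1 hj).2]
    exact hQ0 _
  rw [← Finset.prod_sdiff hμ, hin, hout, Finset.prod_sub, delta, hH, Finset.mul_sum]
  refine Finset.sum_congr rfl fun T hT => ?_
  rw [Q.tensor_prod hμ, smul_eq_mul, ← Finset.prod_sdiff (Finset.mem_powerset.1 hT)]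
  have h1 : ∏ j ∈ μ.support \ T, Q.quad (μ j - if j ∈ T then 1 else 0) (Hnorm (ν j)) =
      ∏ j ∈ μ.support \ T, Q.quad (μ j) (Hnorm (ν j)) :=
    Finset.prod_congr rfl fun j hj => by simp [(Finset.mem_sdiff.1 hj).2]
  have h2 : ∏ j ∈ T, Q.quad (μ j - if j ∈ T then 1 else 0) (Hnorm (ν j)) =
      ∏ j ∈ T, Q.quad (μ j - 1) (Hnorm (ν j)) :=
    Finset.prod_congr rfl fun j hj => by simp [hj]
  rw [h1, h2]
  ring

theorem quad_Hnorm (hA1 : Q.ExactA1) {l n : ℕ} (h : n ≤ l) :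
    Q.quad l (Hnorm n) = if n = 0 then 1 else 0 := by
  rw [Hnorm_eq_eval, hA1 l _ ((natDegree_hermitePoly_le n).trans h),
    ← Hnorm_eq_eval]
  cases n with
  | zero => simp [funext Hnorm_zero]
  | succ n => simpa using integral_Hnorm_succ n

theorem hermiteDiff_eq_zero (hA1 : Q.ExactA1) {m n : ℕ} (h : n < m) :
    Q.hermiteDiff m n = 0 := by
  obtain ⟨m, rfl⟩ := Nat.exists_eq_succ_of_ne_zero (Nat.ne_zero_of_lt h)
  rw [hermiteDiff, quad_Hnorm hA1 h.le, quad_Hnorm hA1 (Nat.le_of_lt_succ h), sub_self]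

theorem sum_hermiteDiff (n l : ℕ) :
    ∑ m ∈ Finset.range (l + 1), Q.hermiteDiff m n = Q.quad l (Hnorm n) := by
  rw [Finset.sum_range_succ']
  simp only [hermiteDiff]
  rw [Finset.sum_range_sub (fun m => Q.quad m (Hnorm n))]
  ring

theorem sum_abs_hermiteDiff_le (hA2 : Q.BoundedA2) {n : ℕ} (hn : n ≠ 0) :
    ∑ m ∈ Finset.range (n + 1), |Q.hermiteDiff m n| ≤ (1 + (n : ℝ)) ^ 3 := by
  rw [Finset.sum_range_succ']
  have h0 : |Q.hermiteDiff 0 n| ≤ 2 := (hA2 0 n).le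
  have h1 : ∑ m ∈ Finset.range n, |Q.hermiteDiff (m + 1) n| ≤ n * 4 := by
    have h := Finset.sum_le_card_nsmul (Finset.range n) (fun m => |Q.hermiteDiff (m + 1) n|) 4
      fun m _ => by
        have := abs_sub (Q.quad (m + 1) (Hnorm n)) (Q.quad m (Hnorm n))
        have := hA2 (m + 1) n
        have := hA2 m n
        simp only [hermiteDiff]
        linarith
    simpa using h
  have hn1 : (1 : ℝ) ≤ n := by exact_mod_cast Nat.one_le_iff_ne_zero.2 hn
  nlinarith [pow_nonneg (zero_le_one.trans hn1) 3]

/-- `Δ_μ H_ν` vanishes unless `μ ≤ ν`. -/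
theorem delta_Hmulti_eq_zero (hQ0 : Q.ZeroRule) (hA1 : Q.ExactA1) {μ ν : ℕ →₀ ℕ}
    (h : ¬ μ ≤ ν) : Q.delta μ (Hmulti ν) = 0 := by
  rw [delta_Hmulti hQ0 μ ν Finset.subset_union_left Finset.subset_union_right]
  obtain ⟨j, hj⟩ : ∃ j, ν j < μ j := by
    simpa [Finsupp.le_def] using h
  refine Finset.prod_eq_zero (i := j) ?_ (hermiteDiff_eq_zero hA1 hj)
  exact Finset.mem_union_left _ (Finsupp.mem_support_iff.2 (Nat.ne_zero_of_lt hj))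

theorem delta_Hmulti_of_le (hQ0 : Q.ZeroRule) {μ ν : ℕ →₀ ℕ} (h : μ ≤ ν) :
    Q.delta μ (Hmulti ν) = ∏ j ∈ ν.support, Q.hermiteDiff (μ j) (ν j) :=
  delta_Hmulti hQ0 μ ν (Finsupp.support_mono h) subset_rfl

/-- The sparse quadrature is exact on `H_ν` for `ν ∈ Λ`. -/
theorem sparse_Hmulti_of_mem (hQ0 : Q.ZeroRule) (hA1 : Q.ExactA1) {Λ : Finset (ℕ →₀ ℕ)}
    (hΛ : IsLowerSet (Λ : Set (ℕ →₀ ℕ))) {ν : ℕ →₀ ℕ} (hν : ν ∈ Λ) :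
    Q.sparse Λ (Hmulti ν) = if ν = 0 then 1 else 0 := by
  have hsub : Finset.Iic ν ⊆ Λ := fun μ hμ => hΛ (Finset.mem_Iic.1 hμ) hν
  rw [sparse, ← Finset.sum_subset hsub fun μ _ hμ =>
      delta_Hmulti_eq_zero hQ0 hA1 (by simpa using hμ),
    Finset.sum_congr rfl fun μ hμ => delta_Hmulti_of_le hQ0 (Finset.mem_Iic.1 hμ),
    Finsupp.sum_Iic_prod ν fun j m => Q.hermiteDiff m (ν j)]
  simp only [sum_hermiteDiff, quad_Hnorm hA1 le_rfl]
  split_ifs with h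
  · simp [h]
  · obtain ⟨j, hj⟩ := Finsupp.support_nonempty_iff.2 h
    exact Finset.prod_eq_zero hj (if_neg (Finsupp.mem_support_iff.1 hj))

theorem abs_sparse_Hmulti_le (hQ0 : Q.ZeroRule) (hA1 : Q.ExactA1) (hA2 : Q.BoundedA2)
    (Λ : Finset (ℕ →₀ ℕ)) (ν : ℕ →₀ ℕ) : |Q.sparse Λ (Hmulti ν)| ≤ cwt ν := by
  classical
  calc |Q.sparse Λ (Hmulti ν)| ≤ ∑ μ ∈ Λ, |Q.delta μ (Hmulti ν)| :=
        Finset.abs_sum_le_sum_abs _ _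
    _ = ∑ μ ∈ Λ ∩ Finset.Iic ν, |Q.delta μ (Hmulti ν)| := by
        refine (Finset.sum_subset Finset.inter_subset_left fun μ hμ hn => ?_).symm
        rw [delta_Hmulti_eq_zero hQ0 hA1 (by simpa [hμ] using hn), abs_zero]
    _ ≤ ∑ μ ∈ Finset.Iic ν, |Q.delta μ (Hmulti ν)| :=
        Finset.sum_le_sum_of_subset_of_nonneg Finset.inter_subset_right
          fun _ _ _ => abs_nonneg _
    _ = ∑ μ ∈ Finset.Iic ν, ∏ j ∈ ν.support, |Q.hermiteDiff (μ j) (ν j)| :=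
        Finset.sum_congr rfl fun μ hμ => by
          rw [delta_Hmulti_of_le hQ0 (Finset.mem_Iic.1 hμ), Finset.abs_prod]
    _ = ∏ j ∈ ν.support, ∑ m ∈ Finset.range (ν j + 1), |Q.hermiteDiff m (ν j)| :=
        Finsupp.sum_Iic_prod ν fun j m => |Q.hermiteDiff m (ν j)|
    _ ≤ cwt ν := Finset.prod_le_prod
        (fun _ _ => Finset.sum_nonneg fun _ _ => abs_nonneg _)
        fun j hj => sum_abs_hermiteDiff_le hA2 (Finsupp.mem_support_iff.1 hj)

section HasSum

variable {S : Type*} [NormedAddCommGroup S] [NormedSpace ℝ S] {f : (ℕ → ℝ) → S}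
  {ι : Type*} {h : ι → (ℕ → ℝ) → ℝ} {a : ι → S}

theorem hasSum_tensor (Q : QuadFamily)
    (hf : ∀ y : ℕ → ℝ, {j | y j ≠ 0}.Finite → HasSum (fun i => h i y • a i) (f y))
    (s : Finset ℕ) (lev : ℕ → ℕ) :
    HasSum (fun i => Q.tensor s lev (h i) • a i) (Q.tensor s lev f) := by
  simp only [tensor, Finset.sum_smul, smul_eq_mul, mul_smul]
  refine hasSum_sum fun k _ => HasSum.const_smul _ (hf _ ?_)
  refine s.finite_toSet.subset fun j hj => ?_
  by_contra hjs
  exact hj (dif_neg hjs)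

theorem hasSum_sparse (Q : QuadFamily)
    (hf : ∀ y : ℕ → ℝ, {j | y j ≠ 0}.Finite → HasSum (fun i => h i y • a i) (f y))
    (Λ : Finset (ℕ →₀ ℕ)) :
    HasSum (fun i => Q.sparse Λ (h i) • a i) (Q.sparse Λ f) := by
  simp only [sparse, delta, Finset.sum_smul, smul_eq_mul, mul_smul]
  exact hasSum_sum fun ν _ => hasSum_sum fun T _ =>
    HasSum.const_smul _ (Q.hasSum_tensor hf _ _)

end HasSum

end QuadFamily

theorem cwt_zero : cwt 0 = 1 := by
  simp [cwt]

/-- On `H_ν` with `ν ∉ Λ` the quadrature error is at most `c_ν`. -/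
theorem QuadFamily.abs_error_Hmulti_le {Q : QuadFamily} (hQ0 : Q.ZeroRule) (hA1 : Q.ExactA1)
    (hA2 : Q.BoundedA2) {Λ : Finset (ℕ →₀ ℕ)} (hΛ : IsLowerSet (Λ : Set (ℕ →₀ ℕ)))
    {ν : ℕ →₀ ℕ} (hν : ν ∉ Λ) :
    |(if ν = 0 then 1 else 0) - Q.sparse Λ (Hmulti ν)| ≤ cwt ν := by
  split_ifs with h
  · subst h
    have hempty : Λ = ∅ := Finset.eq_empty_of_forall_notMem fun μ hμ =>
      hν (hΛ (zero_le (a := μ)) hμ)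
    simp [hempty, QuadFamily.sparse, cwt_zero]
  · rw [zero_sub, abs_neg]
    exact abs_sparse_Hmulti_le hQ0 hA1 hA2 Λ ν

/-- The sparse quadrature error is bounded by the weighted tail sum of the Hermite
coefficients: `‖I(f) - Q_Λ(f)‖ ≤ Σ_{ν ∉ Λ} c_ν ‖f_ν‖`. -/
theorem sparse_quadrature_error_le_weighted_tail
    {S : Type*} [NormedAddCommGroup S] [NormedSpace ℝ S] [CompleteSpace S]
    (Q : QuadFamily) (hQ0 : Q.ZeroRule) (hA1 : Q.ExactA1) (hA2 : Q.BoundedA2)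
    (f : (ℕ → ℝ) → S) (hf_int : Integrable f gaussianProd)
    (hconv : ∀ y : ℕ → ℝ, {j | y j ≠ 0}.Finite →
      Summable (fun ν : ℕ →₀ ℕ => ‖Hmulti ν y • hermiteCoeff f ν‖) ∧
      HasSum (fun ν : ℕ →₀ ℕ => Hmulti ν y • hermiteCoeff f ν) (f y))
    (hsum : Summable (fun ν : ℕ →₀ ℕ => cwt ν * ‖hermiteCoeff f ν‖))
    (Λ : Finset (ℕ →₀ ℕ)) (hΛ : IsLowerSet (Λ : Set (ℕ →₀ ℕ))) :
    ‖(∫ y, f y ∂gaussianProd) - Q.sparse Λ f‖ ≤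
      ∑' ν : {ν : ℕ →₀ ℕ // ν ∉ Λ}, cwt ↑ν * ‖hermiteCoeff f ↑ν‖ := by
  set e : (ℕ →₀ ℕ) → S := fun ν =>
    ((if ν = 0 then 1 else 0) - Q.sparse Λ (Hmulti ν)) • hermiteCoeff f ν with he
  have hI : HasSum (fun ν : ℕ →₀ ℕ => (if ν = 0 then (1 : ℝ) else 0) • hermiteCoeff f ν)
      (∫ y, f y ∂gaussianProd) := by
    have h := hasSum_single (f := fun ν : ℕ →₀ ℕ =>
      (if ν = 0 then (1 : ℝ) else 0) • hermiteCoeff f ν) 0 fun ν hν => by simp [hν]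
    simpa [hermiteCoeff_zero] using h
  have hE : HasSum e ((∫ y, f y ∂gaussianProd) - Q.sparse Λ f) := by
    simpa only [he, sub_smul] using hI.sub (Q.hasSum_sparse (fun y hy => (hconv y hy).2) Λ)
  have hvanish : Function.support e ⊆ {ν | ν ∉ Λ} := by
    intro ν hν hmem
    refine hν ?_
    simp only [he]
    rw [QuadFamily.sparse_Hmulti_of_mem hQ0 hA1 hΛ hmem, sub_self, zero_smul]
  have hE' : HasSum (fun ν : {ν : ℕ →₀ ℕ // ν ∉ Λ} => e ν)
      ((∫ y, f y ∂gaussianProd) - Q.sparse Λ f) :=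
    (hasSum_subtype_iff_of_support_subset hvanish).2 hE
  rw [← hE'.tsum_eq]
  refine tsum_of_norm_bounded (hsum.subtype {ν | ν ∉ Λ}).hasSum fun ν => ?_
  simp only [he, norm_smul, Real.norm_eq_abs]
  exact mul_le_mul_of_nonneg_right (QuadFamily.abs_error_Hmulti_le hQ0 hA1 hA2 hΛ ν.2)
    (norm_nonneg _)
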